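/- arXiv:0705.2168 — 2 statements merged into one kernel-verified Lean document; each statement's English description precedes it below -/
import Mathlib

section
/- Let X be a skew-adjoint endomorphism of V and v ∈ V, and let E be the subspace of V spanned by {X^j v : j ∈ ℕ} (which is X-stable). Then the G-orbit of (X, v) is closed in End(V) × V if and only if the restriction of ⟨·,·⟩ to E is nondegenerate and the restriction of X to the orthogonal complement E^⊥ (which is X-stable whenever ⟨·,·⟩ restricted to E is nondegenerate) is a semisimple endomorphism, i.e. every X-invariant subspace of E^⊥ has an X-invariant complement in E^⊥. -/
section HelperLemmas

open Polynomial Filter Topology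

/-- A nondegenerate form, `σ`-hermitian for an involution `σ` of the base field. -/
structure IsHermForm {D V : Type*} [Field D] [AddCommGroup V] [Module D V]
    (σ : D ≃+* D) (B : V → V → D) : Prop where
  invol : ∀ d, σ (σ d) = d
  add_left : ∀ v v' w, B (v + v') w = B v w + B v' w
  add_right : ∀ v w w', B v (w + w') = B v w + B v w'
  smul : ∀ (d d' : D) (v w : V), B (d • v) (d' • w) = d * σ d' * B v w
  conj : ∀ v w, B w v = σ (B v w)
  nondeg : ∀ v, (∀ w, B v w = 0) → v = 0

section Orbit

variable {D V : Type*} [NontriviallyNormedField D] [NormedAddCommGroup V] [NormedSpace D V]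
  {B : V → V → D}

/-- `UConj B p q` says that `p` and `q` are in the same orbit of the unitary group of `B`. -/
def UConj (B : V → V → D) (p q : (V →L[D] V) × V) : Prop :=
  ∃ g : V ≃L[D] V, (∀ a b, B (g a) (g b) = B a b) ∧ (∀ x, q.1 (g x) = g (p.1 x)) ∧ q.2 = g p.2

theorem UConj.symm {p q : (V →L[D] V) × V} (H : UConj B p q) : UConj B q p := by
  obtain ⟨g, hg, h1, h2⟩ := H
  refine ⟨g.symm, fun a b => ?_, fun x => ?_, ?_⟩
  · rw [← hg]; simp
  · apply g.injective; rw [← h1]; simp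
  · rw [h2]; simp

theorem UConj.trans {p q r : (V →L[D] V) × V} (H : UConj B p q) (H' : UConj B q r) :
    UConj B p r := by
  obtain ⟨g, hg, h1, h2⟩ := H
  obtain ⟨k, hk, h3, h4⟩ := H'
  exact ⟨g.trans k, fun a b => by simp [hk, hg], fun x => by simp [h3, h1], by simp [h4, h2]⟩

theorem uConj_iff (p q : (V →L[D] V) × V) :
    UConj B p q ↔ ∃ g : V ≃L[D] V, (∀ a b : V, B (g a) (g b) = B a b) ∧
          q = ((g : V →L[D] V).comp (p.1.comp (g.symm : V →L[D] V)), g p.2) := by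
  refine exists_congr fun g => and_congr_right fun _ => ?_
  rw [Prod.ext_iff]
  refine and_congr_left fun _ => ⟨fun H => ?_, fun H x => ?_⟩
  · ext x
    simp [← H]
  · simp [H]

theorem continuous_aeval_apply (f : D[X]) :
    Continuous fun p : (V →L[D] V) × V => aeval p.1 f p.2 :=
  ((Polynomial.continuous_aeval f).comp continuous_fst).clm_apply continuous_snd

theorem aeval_apply_of_semiconj {S T : V →L[D] V} {g : V → V} {s : Set V} (hs : ∀ x ∈ s, T x ∈ s)
    (hadd : ∀ x y, g (x + y) = g x + g y) (hsmul : ∀ (c : D) x, g (c • x) = c • g x)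
    (hg : ∀ x ∈ s, S (g x) = g (T x)) (f : D[X]) {x : V} (hx : x ∈ s) :
    aeval S f (g x) = g (aeval T f x) := by
  induction f using Polynomial.induction_on' with
  | add f f' hf hf' => simp [hf, hf', hadd]
  | monomial n r =>
    have H : ∀ n : ℕ, (T ^ n) x ∈ s ∧ (S ^ n) (g x) = g ((T ^ n) x) := by
      intro n
      induction n with
      | zero => simp [hx]
      | succ n ih =>
        refine ⟨?_, ?_⟩
        · rw [pow_succ', mul_apply_eq_comp]; exact hs _ ih.1
        · rw [pow_succ', pow_succ', mul_apply_eq_comp, mul_apply_eq_comp, ih.2, hg _ ih.1]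
    simp only [aeval_monomial, ← Algebra.smul_def, smul_apply, (H n).2, hsmul]

end Orbit

namespace IsHermForm

section Algebraic

variable {D V : Type*} [Field D] [AddCommGroup V] [Module D V]
  {σ : D ≃+* D} {B : V → V → D}

theorem smul_left (h : IsHermForm σ B) (c : D) (x y : V) : B (c • x) y = c * B x y := by
  simpa using h.smul c 1 x y

theorem smul_right (h : IsHermForm σ B) (c : D) (x y : V) : B x (c • y) = σ c * B x y := by
  simpa using h.smul 1 c x y

/-- The linear functional `x ↦ B x y`. -/
def flatₗ (h : IsHermForm σ B) (y : V) : V →ₗ[D] D where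
  toFun x := B x y
  map_add' a b := h.add_left a b y
  map_smul' c a := h.smul_left c a y

@[simp] theorem flatₗ_apply (h : IsHermForm σ B) (x y : V) : h.flatₗ y x = B x y := rfl

theorem zero_left (h : IsHermForm σ B) (y : V) : B 0 y = 0 := (h.flatₗ y).map_zero

theorem neg_left (h : IsHermForm σ B) (x y : V) : B (-x) y = -B x y := (h.flatₗ y).map_neg x

theorem sub_left (h : IsHermForm σ B) (x x' y : V) : B (x - x') y = B x y - B x' y :=
  (h.flatₗ y).map_sub x x'

theorem sum_left (h : IsHermForm σ B) {ι : Type*} (s : Finset ι) (f : ι → V) (y : V) :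
    B (∑ i ∈ s, f i) y = ∑ i ∈ s, B (f i) y := map_sum (h.flatₗ y) f s

theorem zero_right (h : IsHermForm σ B) (x : V) : B x 0 = 0 := by
  rw [h.conj, h.zero_left, map_zero]

theorem neg_right (h : IsHermForm σ B) (x y : V) : B x (-y) = -B x y := by
  rw [h.conj, h.neg_left, map_neg, ← h.conj]

theorem sub_right (h : IsHermForm σ B) (x y y' : V) : B x (y - y') = B x y - B x y' := by
  rw [h.conj, h.sub_left, map_sub, ← h.conj, ← h.conj]

theorem sum_right (h : IsHermForm σ B) {ι : Type*} (s : Finset ι) (x : V) (f : ι → V) :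
    B x (∑ i ∈ s, f i) = ∑ i ∈ s, B x (f i) := by
  rw [h.conj, h.sum_left, map_sum]
  simp_rw [← h.conj]

theorem eq_zero_comm (h : IsHermForm σ B) {x y : V} : B x y = 0 ↔ B y x = 0 := by
  rw [h.conj y x]; simp

theorem ext_left (h : IsHermForm σ B) {x x' : V} (H : ∀ y, B x y = B x' y) : x = x' :=
  sub_eq_zero.1 <| h.nondeg _ fun w => by rw [h.sub_left, H, sub_self]

theorem ext_right (h : IsHermForm σ B) {y y' : V} (H : ∀ x, B x y = B x y') : y = y' :=
  h.ext_left fun x => by rw [h.conj, H, ← h.conj]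

theorem exists_flatₗ_eq (h : IsHermForm σ B) [FiniteDimensional D V] (f : V →ₗ[D] D) :
    ∃ y, ∀ x, f x = B x y := by
  let W : Submodule D (Module.Dual D V) :=
    { carrier := {f | ∃ y, ∀ x, f x = B x y}
      add_mem' := by
        rintro f g ⟨y, hy⟩ ⟨z, hz⟩
        exact ⟨y + z, fun x => by simp [hy, hz, h.add_right]⟩
      zero_mem' := ⟨0, fun x => by simp [h.zero_right]⟩
      smul_mem' := by
        rintro c f ⟨y, hy⟩
        exact ⟨σ c • y, fun x => by simp [hy, h.smul_right, h.invol]⟩ }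
  have hbot : W.dualCoannihilator = ⊥ := by
    rw [eq_bot_iff]
    intro x hx
    rw [Submodule.mem_dualCoannihilator] at hx
    exact h.nondeg x fun y => hx (h.flatₗ y) ⟨y, fun _ => rfl⟩
  have htop : W = ⊤ := by
    rw [← Subspace.dualCoannihilator_dualAnnihilator_eq (W := W), hbot,
      Submodule.dualAnnihilator_bot]
  have : f ∈ W := htop ▸ Submodule.mem_top
  exact this

theorem exists_dual (h : IsHermForm σ B) [FiniteDimensional D V] :
    ∃ b b' : Fin (Module.finrank D V) → V, ∀ x, x = ∑ i, B x (b' i) • b i := by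
  have H := fun i => h.exists_flatₗ_eq ((Module.finBasis D V).coord i)
  choose b' hb' using H
  refine ⟨Module.finBasis D V, b', fun x => ?_⟩
  simp_rw [← hb']
  exact ((Module.finBasis D V).sum_repr x).symm

/-- A spanning family. -/
noncomputable def vec (h : IsHermForm σ B) [FiniteDimensional D V] :
    Fin (Module.finrank D V) → V := h.exists_dual.choose

/-- The family dual to `vec`. -/
noncomputable def dualVec (h : IsHermForm σ B) [FiniteDimensional D V] :
    Fin (Module.finrank D V) → V := h.exists_dual.choose_spec.choose

theorem sum_vec (h : IsHermForm σ B) [FiniteDimensional D V] (x : V) :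
    ∑ i, B x (h.dualVec i) • h.vec i = x := (h.exists_dual.choose_spec.choose_spec x).symm

theorem sum_dualVec (h : IsHermForm σ B) [FiniteDimensional D V] (x : V) :
    ∑ i, B x (h.vec i) • h.dualVec i = x := by
  refine h.ext_right fun z => ?_
  conv_rhs => rw [← h.sum_vec z]
  rw [h.sum_right, h.sum_left]
  refine Finset.sum_congr rfl fun i _ => ?_
  rw [h.smul_right, h.smul_left, ← h.conj, mul_comm]

/-- The restriction of a hermitian form to a subspace on which it is nondegenerate. -/
theorem restrict (h : IsHermForm σ B) (E : Submodule D V)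
    (hE : ∀ u ∈ E, (∀ u' ∈ E, B u u' = 0) → u = 0) :
    IsHermForm σ (fun x y : E => B x y) where
  invol := h.invol
  add_left _ _ _ := h.add_left _ _ _
  add_right _ _ _ := h.add_right _ _ _
  smul _ _ _ _ := h.smul _ _ _ _
  conj _ _ := h.conj _ _
  nondeg v hv := Subtype.ext <| hE v v.2 fun u hu => hv ⟨u, hu⟩

end Algebraic

section Topological

variable {D V : Type*} [NontriviallyNormedField D] [CompleteSpace D]
  [NormedAddCommGroup V] [NormedSpace D V] [FiniteDimensional D V]
  {σ : D ≃+* D} {B : V → V → D}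

/-- The continuous linear functional `x ↦ B x y`. -/
noncomputable def flat (h : IsHermForm σ B) (y : V) : V →L[D] D :=
  LinearMap.toContinuousLinearMap (h.flatₗ y)

@[simp] theorem flat_apply (h : IsHermForm σ B) (x y : V) : h.flat y x = B x y := rfl

theorem continuous_flat (h : IsHermForm σ B) (hσ : Continuous σ) : Continuous h.flat := by
  have : h.flat = fun y => ∑ i, σ (h.flat (h.dualVec i) y) • h.flat (h.vec i) := by
    ext y x
    conv_lhs => rw [← h.sum_vec y]
    simp [h.sum_right, h.smul_right]
  rw [this]
  fun_prop

theorem continuous_form (h : IsHermForm σ B) (hσ : Continuous σ) {α : Type*} [TopologicalSpace α]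
    {f g : α → V} (hf : Continuous f) (hg : Continuous g) :
    Continuous fun a => B (f a) (g a) :=
  ((h.continuous_flat hσ).comp hg).clm_apply hf

/-- The adjoint of an endomorphism. -/
noncomputable def adj (h : IsHermForm σ B) (T : V →L[D] V) : V →L[D] V :=
  ∑ i, (h.flat (T (h.dualVec i))).smulRight (h.vec i)

theorem adj_left (h : IsHermForm σ B) (T : V →L[D] V) (x y : V) :
    B (h.adj T x) y = B x (T y) := by
  conv_rhs => rw [← h.sum_dualVec y]
  simp only [adj, _root_.sum_apply, ContinuousLinearMap.smulRight_apply, flat_apply,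
    map_sum, map_smul, h.sum_left, h.sum_right, h.smul_left, h.smul_right, ← h.conj]
  exact Finset.sum_congr rfl fun i _ => mul_comm _ _

theorem adj_right (h : IsHermForm σ B) (T : V →L[D] V) (x y : V) :
    B x (h.adj T y) = B (T x) y := by
  rw [h.conj, h.adj_left, ← h.conj]

theorem continuous_adj (h : IsHermForm σ B) (hσ : Continuous σ) : Continuous h.adj := by
  unfold adj
  have := h.continuous_flat hσ
  refine continuous_finsetSum _ fun i _ => ?_
  have h1 : Continuous fun T : V →L[D] V => h.flat (T (h.dualVec i)) :=
    this.comp (by fun_prop)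
  exact ((ContinuousLinearMap.smulRightL D V V).flip (h.vec i)).continuous.comp h1

theorem adj_eq (h : IsHermForm σ B) {S T : V →L[D] V} (H : ∀ x y, B (T x) y = B x (S y)) :
    h.adj T = S := by
  ext y
  exact h.ext_right fun x => by rw [h.adj_right, H]

theorem adj_mul (h : IsHermForm σ B) (S T : V →L[D] V) : h.adj (S * T) = h.adj T * h.adj S :=
  h.adj_eq fun x y => by simp [h.adj_right]

theorem adj_adj (h : IsHermForm σ B) (T : V →L[D] V) : h.adj (h.adj T) = T :=
  h.adj_eq fun x y => by simp [h.adj_left]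

theorem adj_one (h : IsHermForm σ B) : h.adj 1 = 1 := h.adj_eq fun x y => by simp

theorem adj_add (h : IsHermForm σ B) (S T : V →L[D] V) : h.adj (S + T) = h.adj S + h.adj T :=
  h.adj_eq fun x y => by simp [h.adj_right, h.add_left, h.add_right]

theorem adj_sub (h : IsHermForm σ B) (S T : V →L[D] V) : h.adj (S - T) = h.adj S - h.adj T :=
  h.adj_eq fun x y => by simp [h.adj_right, h.sub_left, h.sub_right]

theorem adj_smul (h : IsHermForm σ B) (c : D) (T : V →L[D] V) :
    h.adj (c • T) = σ c • h.adj T :=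
  h.adj_eq fun x y => by simp [h.adj_right, h.smul_left, h.smul_right, h.invol]

theorem adj_eq_neg (h : IsHermForm σ B) {X : V →L[D] V} (hX : ∀ a b, B (X a) b = -B a (X b)) :
    h.adj X = -X := h.adj_eq fun x y => by simp [hX, h.neg_right]

theorem exists_adj_aeval (h : IsHermForm σ B) {X : V →L[D] V} (hX : h.adj X = -X) (p : D[X]) :
    ∃ q : D[X], h.adj (aeval X p) = aeval X q := by
  induction p using Polynomial.induction_on' with
  | add p q hp hq =>
    obtain ⟨p', hp'⟩ := hp
    obtain ⟨q', hq'⟩ := hq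
    exact ⟨p' + q', by rw [map_add, h.adj_add, hp', hq', map_add]⟩
  | monomial n a =>
    have H : ∀ n : ℕ, h.adj (X ^ n) = (-X) ^ n := by
      intro n
      induction n with
      | zero => simp [h.adj_one]
      | succ n ih => rw [pow_succ, h.adj_mul, ih, hX, ← pow_succ']
    refine ⟨C (σ a) * (-Polynomial.X) ^ n, ?_⟩
    simp only [aeval_monomial, map_mul, aeval_C, map_pow, map_neg, aeval_X]
    rw [← Algebra.smul_def, ← Algebra.smul_def, h.adj_smul, H]

theorem uConj_of_isometry (h : IsHermForm σ B) {p q : (V →L[D] V) × V} (G : V →L[D] V)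
    (hG : ∀ a b, B (G a) (G b) = B a b) (h1 : ∀ x, q.1 (G x) = G (p.1 x)) (h2 : q.2 = G p.2) :
    UConj B p q := by
  have inj : Function.Injective (G : V →ₗ[D] V) := by
    rw [← LinearMap.ker_eq_bot, LinearMap.ker_eq_bot']
    intro x hx
    refine h.nondeg x fun w => ?_
    rw [← hG]
    have : G x = 0 := hx
    rw [this, h.zero_left]
  let e := (LinearEquiv.ofInjectiveEndo (G : V →ₗ[D] V) inj).toContinuousLinearEquiv
  have he : ∀ x, e x = G x := fun x => rfl
  exact ⟨e, fun a b => by simp only [he, hG], fun x => by simp only [he, h1],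
    by simp only [he, h2]⟩

end Topological

section LocalConjugacy

/-- The noncommutative divided difference `(μ(S) - μ(T)) / (S - T)`. -/
noncomputable def dividedDiff {D A : Type*} [Field D] [Ring A] [Algebra D A] (μ : D[X]) (S T : A) :
    A :=
  μ.sum fun k c => c • ∑ i ∈ Finset.range k, S ^ i * T ^ (k - 1 - i)

theorem mul_dividedDiff {D A : Type*} [Field D] [Ring A] [Algebra D A] (μ : D[X]) (S T : A) :
    S * dividedDiff μ S T - dividedDiff μ S T * T = aeval S μ - aeval T μ := by
  have key : ∀ k : ℕ, S * (∑ i ∈ Finset.range k, S ^ i * T ^ (k - 1 - i)) -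
      (∑ i ∈ Finset.range k, S ^ i * T ^ (k - 1 - i)) * T = S ^ k - T ^ k := by
    intro k
    have h1 : ∀ i ∈ Finset.range k, S * (S ^ i * T ^ (k - 1 - i)) - S ^ i * T ^ (k - 1 - i) * T =
        S ^ (i + 1) * T ^ (k - (i + 1)) - S ^ i * T ^ (k - i) := by
      intro i hi
      rw [Finset.mem_range] at hi
      rw [show k - 1 - i = k - (i + 1) by omega, show k - i = k - (i + 1) + 1 by omega, pow_succ T,
        pow_succ' S, mul_assoc, mul_assoc]
    rw [Finset.mul_sum, Finset.sum_mul, ← Finset.sum_sub_distrib, Finset.sum_congr rfl h1,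
      Finset.sum_range_sub (fun i => S ^ i * T ^ (k - i))]
    simp
  rw [aeval_eq_sum_range, aeval_eq_sum_range, dividedDiff, sum_over_range _ (by simp),
    Finset.mul_sum, Finset.sum_mul, ← Finset.sum_sub_distrib, ← Finset.sum_sub_distrib]
  refine Finset.sum_congr rfl fun k _ => ?_
  rw [mul_smul_comm, smul_mul_assoc, ← smul_sub, key, smul_sub]

theorem dividedDiff_self {D A : Type*} [Field D] [Ring A] [Algebra D A] (μ : D[X]) (T : A) :
    dividedDiff μ T T = aeval T (derivative μ) := by
  rw [derivative_apply, dividedDiff, Polynomial.sum, Polynomial.sum, map_sum]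
  refine Finset.sum_congr rfl fun k _ => ?_
  have h1 : ∀ i ∈ Finset.range k, T ^ i * T ^ (k - 1 - i) = T ^ (k - 1) := by
    intro i hi
    rw [Finset.mem_range] at hi
    rw [← pow_add]
    congr 1
    omega
  rw [Finset.sum_congr rfl h1, Finset.sum_const, Finset.card_range, map_mul, map_pow, aeval_X,
    aeval_C, ← Algebra.smul_def, mul_smul, Nat.cast_smul_eq_nsmul]

theorem continuous_dividedDiff {D A : Type*} [Field D] [Ring A] [Algebra D A] [TopologicalSpace A]
    [IsTopologicalRing A] [ContinuousConstSMul D A] (μ : D[X]) (T : A) :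
    Continuous fun S => dividedDiff μ S T := by
  unfold dividedDiff Polynomial.sum
  fun_prop

variable {D : Type*} [NontriviallyNormedField D]

theorem eq_zero_of_mul_add_mul_eq_zero {A : Type*} [NormedRing A] [NormedAlgebra D A] {P Q H : A}
    (hPQ : ‖P - 1‖ + ‖Q - 1‖ < ‖(2 : D)‖) (H0 : P * H + H * Q = 0) : H = 0 := by
  have h1 : (2 : D) • H = -((P - 1) * H + H * (Q - 1)) := by
    rw [two_smul, eq_neg_iff_add_eq_zero, ← H0]; noncomm_ring
  have h2 : ‖(2 : D)‖ * ‖H‖ ≤ (‖P - 1‖ + ‖Q - 1‖) * ‖H‖ := by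
    rw [← norm_smul, h1, norm_neg]
    refine (norm_add_le _ _).trans ?_
    linarith [norm_mul_le (P - 1) H, norm_mul_le H (Q - 1)]
  by_contra hne
  have := norm_pos_iff.2 hne
  nlinarith

variable [CharZero D]

theorem eventually_exists_mul_self {A : Type*} [NormedRing A] [NormedAlgebra D A] [CompleteSpace A]
    {U : Set A} (hU : U ∈ 𝓝 (1 : A)) : ∀ᶠ S in 𝓝 (1 : A), ∃ Z ∈ U, Z * Z = S := by
  have h2 : (2 : D) ≠ 0 := two_ne_zero
  have hd : HasStrictFDerivAt (fun Z : A => Z * Z)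
      ((ContinuousLinearEquiv.smulLeft (Units.mk0 (2 : D) h2) : A ≃L[D] A) : A →L[D] A) 1 := by
    refine ((hasStrictFDerivAt_id (𝕜 := D) (1 : A)).mul'
      (hasStrictFDerivAt_id (𝕜 := D) (1 : A))).congr_fderiv ?_
    ext x
    change (1 : A) * x + x * 1 = (2 : D) • x
    rw [one_mul, mul_one, two_smul]
  have := hd.map_nhds_eq_of_equiv
  simp only [mul_one] at this
  rw [← this, eventually_map]
  filter_upwards [hU] with Z hZ using ⟨Z, hZ, rfl⟩

variable [CompleteSpace D] {V : Type*} [NormedAddCommGroup V] [NormedSpace D V]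
  [FiniteDimensional D V] {σ : D ≃+* D} {B : V → V → D}

/-- An operator close to the identity that intertwines two pairs up to a self-adjoint correction
fixing the vector can be made unitary. -/
theorem eventually_uConj_of_intertwine (h : IsHermForm σ B) (hσ : Continuous σ)
    {p : (V →L[D] V) × V} (hp : h.adj p.1 = -p.1) :
    ∀ᶠ T in 𝓝 (1 : V →L[D] V), ∀ q : (V →L[D] V) × V, h.adj q.1 = -q.1 →
      q.1 * T = T * p.1 → T p.2 = q.2 → h.adj T q.2 = p.2 → UConj B p q := by
  have hcomp : CompleteSpace (V →L[D] V) := by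
    have := FiniteDimensional.complete D V
    infer_instance
  have h2 : 0 < ‖(2 : D)‖ := norm_pos_iff.2 two_ne_zero
  have hU : {Z : V →L[D] V | IsUnit Z ∧ ‖Z - 1‖ < ‖(2 : D)‖ / 2 ∧ ‖h.adj Z - 1‖ < ‖(2 : D)‖ / 2} ∈
      𝓝 1 := by
    have hc := h.continuous_adj hσ
    refine inter_mem (Units.isOpen.mem_nhds isUnit_one) (inter_mem ?_ ?_)
    · refine (show Continuous fun Z : V →L[D] V => ‖Z - 1‖ by fun_prop).tendsto 1
        |>.eventually_lt_const ?_
      simp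
    · refine (show Continuous fun Z : V →L[D] V => ‖h.adj Z - 1‖ by fun_prop).tendsto 1
        |>.eventually_lt_const ?_
      simp [h.adj_one]
  have hS : Tendsto (fun T => h.adj T * T) (𝓝 1) (𝓝 1) := by
    have := h.continuous_adj hσ
    have := (show Continuous fun T => h.adj T * T by fun_prop).tendsto 1
    simpa [h.adj_one] using this
  filter_upwards [hS.eventually (eventually_exists_mul_self (D := D) hU)]
  rintro T ⟨Z, ⟨⟨u, hZdef⟩, hZ1, hZ2⟩, hZT⟩ q hq hT hTp hTq
  have hsa : h.adj Z = Z := by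
    rw [← sub_eq_zero]
    refine eq_zero_of_mul_add_mul_eq_zero (D := D) (P := h.adj Z) (Q := Z) (by linarith) ?_
    have : h.adj Z * h.adj Z = Z * Z := by
      rw [← h.adj_mul, hZT, h.adj_mul, h.adj_adj]
    rw [mul_sub, sub_mul, this]; abel
  have hcomm : Z * p.1 = p.1 * Z := by
    rw [← sub_eq_zero]
    refine eq_zero_of_mul_add_mul_eq_zero (D := D) (P := Z) (Q := Z) (by linarith) ?_
    have h1 : h.adj T * q.1 = p.1 * h.adj T := by
      have := congrArg h.adj hT
      rw [h.adj_mul, h.adj_mul, hp, hq] at this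
      simpa using this
    have h3 : Z * Z * p.1 = p.1 * (Z * Z) := by
      rw [hZT, mul_assoc, ← hT, ← mul_assoc, h1, mul_assoc]
    calc _ = Z * Z * p.1 - p.1 * (Z * Z) := by noncomm_ring
      _ = 0 := by rw [h3, sub_self]
  have hfix : Z p.2 = p.2 := by
    have h1 : Z (Z p.2) = p.2 := by
      rw [← mul_apply_eq_comp, hZT, mul_apply_eq_comp, hTp, hTq]
    rw [← sub_eq_zero]
    set x := Z p.2 - p.2 with hx
    have h3 : (2 : D) • x = -((Z - 1) x) := by
      rw [two_smul, eq_neg_iff_add_eq_zero]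
      simp [hx, h1]
    have h4 : ‖(2 : D)‖ * ‖x‖ ≤ ‖Z - 1‖ * ‖x‖ := by
      rw [← norm_smul, h3, norm_neg]
      exact (Z - 1).le_opNorm x
    by_contra hne
    have := norm_pos_iff.2 hne
    nlinarith
  have huu : ∀ x, Z ((↑u⁻¹ : V →L[D] V) x) = x := fun x => by
    rw [← mul_apply_eq_comp, ← hZdef, Units.mul_inv]; rfl
  have huu' : ∀ x, (↑u⁻¹ : V →L[D] V) (Z x) = x := fun x => by
    rw [← mul_apply_eq_comp, ← hZdef, Units.inv_mul]; rfl
  refine h.uConj_of_isometry (T * ↑u⁻¹) (fun a b => ?_) (fun x => ?_) ?_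
  · rw [mul_apply_eq_comp, mul_apply_eq_comp, ← h.adj_right,
      ← mul_apply_eq_comp (h.adj T), ← hZT, mul_apply_eq_comp, huu]
    conv_lhs => rw [← hsa, h.adj_right, huu]
  · have h1 : (↑u⁻¹ : V →L[D] V) (p.1 x) = p.1 ((↑u⁻¹ : V →L[D] V) x) := by
      conv_lhs => rw [← huu x, ← mul_apply_eq_comp p.1, ← hcomm,
        mul_apply_eq_comp, huu']
    rw [mul_apply_eq_comp, mul_apply_eq_comp, h1,
      ← mul_apply_eq_comp q.1, hT]
    rfl
  · rw [← hTp, mul_apply_eq_comp]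
    conv_rhs => rw [← hfix, huu']

end LocalConjugacy

section Model

variable {D : Type*} [NontriviallyNormedField D] [CompleteSpace D]
  {V : Type*} [NormedAddCommGroup V] [NormedSpace D V]
  [FiniteDimensional D V] {σ : D ≃+* D} {B : V → V → D} {m : ℕ}

/-- The operator `x ↦ ∑ i, B x (cᵢ(Y) w) • aᵢ(Y') w'` attached to pairs `p = (Y, w)` and
`q = (Y', w')`. -/
noncomputable def transfer (h : IsHermForm σ B) (a c : Fin m → D[X]) (p q : (V →L[D] V) × V) :
    V →L[D] V :=
  ∑ i, (h.flat (aeval p.1 (c i) p.2)).smulRight (aeval q.1 (a i) q.2)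

theorem transfer_apply (h : IsHermForm σ B) (a c : Fin m → D[X]) (p q : (V →L[D] V) × V) (x : V) :
    h.transfer a c p q x = ∑ i, B x (aeval p.1 (c i) p.2) • aeval q.1 (a i) q.2 := by
  simp [transfer]

theorem continuous_transfer (h : IsHermForm σ B) (hσ : Continuous σ) (a c : Fin m → D[X])
    {α : Type*} [TopologicalSpace α] {f g : α → (V →L[D] V) × V} (hf : Continuous f)
    (hg : Continuous g) : Continuous fun x => h.transfer a c (f x) (g x) := by
  refine continuous_finsetSum _ fun i _ => ?_
  exact ((ContinuousLinearMap.smulRightL D V V).continuous.comp ((h.continuous_flat hσ).comp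
    ((continuous_aeval_apply (c i)).comp hf))).clm_apply ((continuous_aeval_apply (a i)).comp hg)

/-- Pairs `(Y, w)` with skew-adjoint `Y` and prescribed Gram matrix of the vectors `Yʲ w`, such that
`transfer` is the orthogonal projection to their span, on whose orthogonal complement `μ(Y)`
vanishes. -/
structure IsModel (h : IsHermForm σ B) (a c : Fin m → D[X]) (μ : D[X]) (γ : D[X] → D[X] → D)
    (p : (V →L[D] V) × V) : Prop where
  skew : ∀ x y, B (p.1 x) y = -B x (p.1 y)
  gram : ∀ f g : D[X], B (aeval p.1 f p.2) (aeval p.1 g p.2) = γ f g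
  transfer_self : ∀ f : D[X], h.transfer a c p p (aeval p.1 f p.2) = aeval p.1 f p.2
  orthogonal : ∀ (x : V) (f : D[X]),
    B (h.transfer a c p p x) (aeval p.1 f p.2) = B x (aeval p.1 f p.2)
  annihilates : ∀ x, aeval p.1 μ (x - h.transfer a c p p x) = 0

variable {h : IsHermForm σ B} {a c : Fin m → D[X]} {μ : D[X]} {γ : D[X] → D[X] → D}
  {p q : (V →L[D] V) × V}

theorem isClosed_isModel (hσ : Continuous σ) : IsClosed {p | IsModel h a c μ γ p} := by
  have hae := continuous_aeval_apply (D := D) (V := V)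
  have htr := h.continuous_transfer hσ a c (continuous_id) (continuous_id)
  have : {p | IsModel h a c μ γ p} = {p : (V →L[D] V) × V | (∀ x y, B (p.1 x) y = -B x (p.1 y)) ∧
      (∀ f g : D[X], B (aeval p.1 f p.2) (aeval p.1 g p.2) = γ f g) ∧
      (∀ f : D[X], h.transfer a c p p (aeval p.1 f p.2) = aeval p.1 f p.2) ∧
      (∀ (x : V) (f : D[X]), B (h.transfer a c p p x) (aeval p.1 f p.2) = B x (aeval p.1 f p.2)) ∧
      (∀ x, aeval p.1 μ (x - h.transfer a c p p x) = 0)} := by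
    ext p
    exact ⟨fun H => ⟨H.1, H.2, H.3, H.4, H.5⟩, fun H => ⟨H.1, H.2.1, H.2.2.1, H.2.2.2.1, H.2.2.2.2⟩⟩
  rw [this]
  simp only [Set.ofPred_and, Set.ofPred_forall]
  refine .inter ?_ (.inter ?_ (.inter ?_ (.inter ?_ ?_)))
  · exact isClosed_iInter fun x => isClosed_iInter fun y => isClosed_eq
      (h.continuous_form hσ (by fun_prop) (by fun_prop))
      (h.continuous_form hσ (by fun_prop) (by fun_prop)).neg
  · exact isClosed_iInter fun f => isClosed_iInter fun g => isClosed_eq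
      (h.continuous_form hσ (hae f) (hae g)) continuous_const
  · exact isClosed_iInter fun f => isClosed_eq (htr.clm_apply (hae f)) (hae f)
  · exact isClosed_iInter fun x => isClosed_iInter fun f => isClosed_eq
      (h.continuous_form hσ (htr.clm_apply continuous_const) (hae f))
      (h.continuous_form hσ continuous_const (hae f))
  · exact isClosed_iInter fun x => isClosed_eq
      (((Polynomial.continuous_aeval μ).comp continuous_fst).clm_apply
        (continuous_const.sub (htr.clm_apply continuous_const))) continuous_const

theorem IsModel.of_uConj (hp : IsModel h a c μ γ p) (H : UConj B p q) : IsModel h a c μ γ q := by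
  obtain ⟨g, hg, h1, h2⟩ := H
  have hae : ∀ f x, aeval q.1 f (g x) = g (aeval p.1 f x) := fun f x =>
    aeval_apply_of_semiconj (s := Set.univ) (fun _ _ => trivial) (map_add g)
      (fun c x => map_smul g c x) (fun x _ => h1 x) f trivial
  have htr : ∀ x, h.transfer a c q q (g x) = g (h.transfer a c p p x) := by
    intro x
    simp only [transfer_apply, h2, hae, hg, map_sum, map_smul]
  refine ⟨fun x y => ?_, fun f f' => ?_, fun f => ?_, fun x f => ?_, fun x => ?_⟩
  · rw [← g.apply_symm_apply x, ← g.apply_symm_apply y, h1, h1, hg, hg, hp.skew]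
  · rw [h2, hae, hae, hg, hp.gram]
  · rw [h2, hae, htr, hp.transfer_self]
  · rw [← g.apply_symm_apply x, h2, hae, htr, hg, hg, hp.orthogonal]
  · rw [← g.apply_symm_apply x, htr, ← map_sub, hae, hp.annihilates, map_zero]

theorem IsModel.adj_eq_neg (hp : IsModel h a c μ γ p) : h.adj p.1 = -p.1 := h.adj_eq_neg hp.skew

theorem exists_transfer_eq (h : IsHermForm σ B) (a c : Fin m → D[X]) (p : (V →L[D] V) × V) (x : V) :
    ∃ g : D[X], ∀ q, h.transfer a c p q x = aeval q.1 g q.2 :=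
  ⟨∑ i, C (B x (aeval p.1 (c i) p.2)) * a i, fun q => by
    simp [transfer_apply, ← Algebra.smul_def]⟩

theorem IsModel.transfer_aeval (hp : IsModel h a c μ γ p) (hq : IsModel h a c μ γ q) (f : D[X]) :
    h.transfer a c p q (aeval p.1 f p.2) = aeval q.1 f q.2 := by
  rw [← hq.transfer_self, transfer_apply, transfer_apply]
  simp_rw [hp.gram, hq.gram]

theorem IsModel.transfer_transfer (hp : IsModel h a c μ γ p) (x : V) :
    h.transfer a c p q (h.transfer a c p p x) = h.transfer a c p q x := by
  simp only [h.transfer_apply a c p q, hp.orthogonal]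

theorem IsModel.transfer_comm (hp : IsModel h a c μ γ p) (hq : IsModel h a c μ γ q) :
    q.1 * h.transfer a c p q = h.transfer a c p q * p.1 := by
  ext x
  obtain ⟨g, hg⟩ := h.exists_transfer_eq a c p x
  have hmul : ∀ (r : (V →L[D] V) × V) (f : D[X]),
      r.1 (aeval r.1 f r.2) = aeval r.1 (Polynomial.X * f) r.2 := fun r f => by
    rw [map_mul, aeval_X, mul_apply_eq_comp]
  have h1 : h.transfer a c p q (p.1 (x - h.transfer a c p p x)) = 0 := by
    rw [transfer_apply]
    refine Finset.sum_eq_zero fun i _ => ?_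
    rw [hp.skew, hmul, h.sub_left, hp.orthogonal, sub_self, neg_zero, zero_smul]
  rw [map_sub, map_sub, sub_eq_zero] at h1
  rw [mul_apply_eq_comp, mul_apply_eq_comp, h1, hg p, hmul, hp.transfer_aeval hq, ← hmul, hg]

theorem IsModel.eventually_uConj [CharZero D] (hσ : Continuous σ) (hμ : μ.Separable)
    (hp : IsModel h a c μ γ p) : ∀ᶠ q in 𝓝 p, IsModel h a c μ γ q → UConj B p q := by
  obtain ⟨s, u, hu⟩ := hμ
  let P : (V →L[D] V) × V → (V →L[D] V) := fun q => 1 - h.transfer a c q q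
  let T : (V →L[D] V) × V → (V →L[D] V) := fun q =>
    h.transfer a c p q + P q * (aeval q.1 u * dividedDiff μ q.1 p.1) * P p
  have hPcomm : ∀ {q}, IsModel h a c μ γ q → q.1 * P q = P q * q.1 := fun {q} hq => by
    simp only [P, mul_sub, sub_mul, hq.transfer_comm hq, mul_one, one_mul]
  have hPann : ∀ {q}, IsModel h a c μ γ q → aeval q.1 μ * P q = 0 := fun {q} hq => by
    ext x
    exact hq.annihilates x
  have hPcomm' : ∀ {q}, IsModel h a c μ γ q → ∀ f : D[X], aeval q.1 f * P q = P q * aeval q.1 f :=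
    fun {q} hq f => by
    ext x
    exact aeval_apply_of_semiconj (s := Set.univ) (fun _ _ => trivial) (map_add (P q))
      (fun c x => map_smul (P q) c x) (fun x _ => DFunLike.congr_fun (hPcomm hq) x) f trivial
  have hPidem : P p * P p = P p := by
    have : h.transfer a c p p * h.transfer a c p p = h.transfer a c p p := by
      ext x
      exact hp.transfer_transfer x
    simp only [P, mul_sub, sub_mul, this, mul_one, one_mul]
    abel
  have hTp : T p = 1 := by
    have h1 : aeval p.1 u * dividedDiff μ p.1 p.1 * P p = P p := by
      have h3 := congrArg (fun f => aeval p.1 f * P p) hu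
      simp only [map_add, map_mul, map_one, one_mul, add_mul] at h3
      rw [mul_assoc, hPann hp, mul_zero, zero_add] at h3
      rw [dividedDiff_self, h3]
    simp only [T]
    rw [mul_assoc, h1, hPidem]
    simp only [P]
    abel
  have hTc : Continuous T := by
    have h1 := h.continuous_transfer hσ a c (continuous_const (y := p)) (continuous_id)
    have h2 := h.continuous_transfer hσ a c (continuous_id) (continuous_id)
    have h3 : Continuous fun q : (V →L[D] V) × V => aeval q.1 u :=
      (Polynomial.continuous_aeval u).comp continuous_fst
    have h4 : Continuous fun q : (V →L[D] V) × V => dividedDiff μ q.1 p.1 :=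
      (continuous_dividedDiff μ p.1).comp continuous_fst
    exact h1.add (((continuous_const.sub h2).mul (h3.mul h4)).mul continuous_const)
  have hlim : Tendsto T (𝓝 p) (𝓝 1) := hTp ▸ hTc.tendsto p
  filter_upwards [hlim.eventually (h.eventually_uConj_of_intertwine hσ hp.adj_eq_neg)] with q H hq
  have hp2 : p.2 = aeval p.1 (1 : D[X]) p.2 := by simp
  have hq2 : q.2 = aeval q.1 (1 : D[X]) q.2 := by simp
  refine H q hq.adj_eq_neg ?_ ?_ ?_
  · have h1 : q.1 * (P q * (aeval q.1 u * dividedDiff μ q.1 p.1) * P p) -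
        P q * (aeval q.1 u * dividedDiff μ q.1 p.1) * P p * p.1 = 0 := by
      have e1 : q.1 * aeval q.1 u = aeval q.1 u * q.1 := by
        have := congrArg (aeval q.1) (mul_comm (Polynomial.X : D[X]) u)
        simpa using this
      calc _ = (q.1 * P q) * aeval q.1 u * dividedDiff μ q.1 p.1 * P p -
            P q * (aeval q.1 u * dividedDiff μ q.1 p.1) * (P p * p.1) := by noncomm_ring
        _ = P q * (q.1 * aeval q.1 u) * dividedDiff μ q.1 p.1 * P p -
            P q * (aeval q.1 u * dividedDiff μ q.1 p.1) * (p.1 * P p) := by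
          rw [hPcomm hq, hPcomm hp]; noncomm_ring
        _ = P q * aeval q.1 u * (q.1 * dividedDiff μ q.1 p.1 - dividedDiff μ q.1 p.1 * p.1) *
            P p := by rw [e1]; noncomm_ring
        _ = (P q * aeval q.1 (u * μ)) * P p - P q * aeval q.1 u * (aeval p.1 μ * P p) := by
          rw [mul_dividedDiff, map_mul]; noncomm_ring
        _ = 0 := by
          rw [hPann hp, mul_comm u, ← hPcomm' hq, map_mul, mul_assoc _ (aeval q.1 u),
            hPcomm' hq, ← mul_assoc, hPann hq]
          simp
    rw [sub_eq_zero] at h1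
    simp only [T, mul_add, add_mul, hp.transfer_comm hq, h1]
  · have h1 : P p p.2 = 0 := by
      have := hp.transfer_self 1
      rw [← hp2] at this
      simp [P, this]
    simp only [T, add_apply, mul_apply_eq_comp, h1, map_zero, add_zero]
    have := hp.transfer_aeval hq 1
    rwa [← hp2, ← hq2] at this
  · refine h.ext_left fun x => ?_
    rw [h.adj_left]
    have h1 : ∀ z, B q.2 (P q z) = 0 := fun z => by
      rw [h.eq_zero_comm]
      have := hq.orthogonal z 1
      rw [← hq2] at this
      change B (z - h.transfer a c q q z) _ = 0
      rw [h.sub_left, this, sub_self]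
    simp only [T, add_apply, mul_apply_eq_comp, h.add_right, h1, add_zero]
    obtain ⟨g, hg⟩ := h.exists_transfer_eq a c p x
    have h3 := hp.orthogonal x 1
    rw [← hp2] at h3
    have h4 : B (aeval q.1 g q.2) q.2 = B (aeval p.1 g p.2) p.2 := by
      have := (hq.gram g 1).trans (hp.gram g 1).symm
      rwa [← hp2, ← hq2] at this
    rw [hg, h.conj, h4, ← hg, h3, ← h.conj]

theorem IsModel.isClosed_orbit [CharZero D] (hσ : Continuous σ) (hμ : μ.Separable)
    (hp : IsModel h a c μ γ p) : IsClosed {q | UConj B p q} := by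
  refine isClosed_of_closure_subset fun q hq => ?_
  have hsub : {q | UConj B p q} ⊆ {q | IsModel h a c μ γ q} := fun q hq => hp.of_uConj hq
  have hqm : IsModel h a c μ γ q := closure_minimal hsub (isClosed_isModel hσ) hq
  obtain ⟨r, hr1, hr2⟩ :=
    ((mem_closure_iff_frequently.1 hq).and_eventually (hqm.eventually_uConj hσ hμ)).exists
  exact UConj.trans hr1 (hr2 (hp.of_uConj hr1)).symm

end Model

section Semisimple

variable {D : Type*} [NontriviallyNormedField D] {V : Type*} [NormedAddCommGroup V]
  [NormedSpace D V]

theorem coe_aeval_restrict (X : V →L[D] V) {F : Submodule D V}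
    (hF : F ∈ Module.End.invtSubmodule (X : V →ₗ[D] V)) (f : D[X]) (x : F) :
    (aeval (LinearMap.restrict (X : V →ₗ[D] V) hF) f x : V) = aeval X f x := by
  induction f using Polynomial.induction_on' with
  | add f g hf hg => simp [hf, hg]
  | monomial n r =>
    have H : ∀ n : ℕ, (((LinearMap.restrict (X : V →ₗ[D] V) hF) ^ n) x : V) = (X ^ n) x := by
      intro n
      induction n with
      | zero => simp
      | succ n ih =>
        rw [pow_succ', pow_succ', Module.End.mul_apply, mul_apply_eq_comp, ← ih]
        rfl
    simp only [aeval_monomial, ← Algebra.smul_def, smul_apply, LinearMap.smul_apply,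
      Submodule.coe_smul, H]

theorem exists_separable_of_isSemisimple [CharZero D] [FiniteDimensional D V] {X : V →L[D] V}
    {F : Submodule D V} {hF : F ∈ Module.End.invtSubmodule (X : V →ₗ[D] V)}
    (hs : Module.End.IsSemisimple (LinearMap.restrict (X : V →ₗ[D] V) hF)) :
    ∃ μ : D[X], μ.Separable ∧ ∀ x ∈ F, aeval X μ x = 0 := by
  refine ⟨minpoly D (LinearMap.restrict (X : V →ₗ[D] V) hF),
    PerfectField.separable_iff_squarefree.2 hs.minpoly_squarefree, fun x hx => ?_⟩
  rw [← coe_aeval_restrict X hF _ ⟨x, hx⟩, minpoly.aeval]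
  rfl

theorem exists_nilpotent_of_not_isSemisimple [FiniteDimensional D V] {X : V →L[D] V}
    {F : Submodule D V} {hF : F ∈ Module.End.invtSubmodule (X : V →ₗ[D] V)}
    (hs : ¬ Module.End.IsSemisimple (LinearMap.restrict (X : V →ₗ[D] V) hF)) :
    ∃ f : D[X], (∃ x ∈ F, aeval X f x ≠ 0) ∧ ∀ x ∈ F, aeval X (f * f) x = 0 := by
  set A := LinearMap.restrict (X : V →ₗ[D] V) hF with hA
  have h_int : IsIntegral D A := Algebra.IsIntegral.isIntegral A
  have hsq : ¬ Squarefree (minpoly D A) := fun H =>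
    hs (Module.End.isSemisimple_of_squarefree_aeval_eq_zero H (minpoly.aeval D A))
  simp only [Squarefree, not_forall] at hsq
  obtain ⟨r, ⟨s, hrs⟩, hr⟩ := hsq
  refine ⟨r * s, ?_, fun x hx => ?_⟩
  · by_contra! H
    have h1 : aeval A (r * s) = 0 := by
      ext x
      rw [hA, coe_aeval_restrict, H x x.2]
      rfl
    obtain ⟨t, ht⟩ := minpoly.dvd D A h1
    have h0 : r * s ≠ 0 := by
      intro h0
      apply minpoly.ne_zero h_int
      rw [hrs, mul_assoc, h0, mul_zero]
    refine hr (IsUnit.of_mul_eq_one t (mul_left_cancel₀ h0 ?_))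
    rw [mul_one]
    conv_rhs => rw [ht, hrs]
    ring
  · rw [← coe_aeval_restrict X hF _ ⟨x, hx⟩,
      show r * s * (r * s) = minpoly D A * s by rw [hrs]; ring, map_mul, ← hA, minpoly.aeval, zero_mul]
    rfl

end Semisimple

section ExistsModel

variable {D : Type*} [NontriviallyNormedField D] [CompleteSpace D]
  {V : Type*} [NormedAddCommGroup V] [NormedSpace D V]
  [FiniteDimensional D V] {σ : D ≃+* D} {B : V → V → D}

theorem exists_isModel (h : IsHermForm σ B) {X : V →L[D] V} (hX : ∀ x y, B (X x) y = -B x (X y))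
    {v : V} {E : Submodule D V} (hE : ∀ x, x ∈ E ↔ ∃ f : D[X], aeval X f v = x)
    (hnd : ∀ u ∈ E, (∀ u' ∈ E, B u u' = 0) → u = 0) {μ : D[X]}
    (hμ : ∀ x, (∀ u ∈ E, B u x = 0) → aeval X μ x = 0) :
    ∃ (m : ℕ) (a c : Fin m → D[X]) (γ : D[X] → D[X] → D), IsModel h a c μ γ (X, v) := by
  have hr := h.restrict E hnd
  choose a ha using fun i => (hE _).1 (hr.vec i).2
  choose c hc using fun i => (hE _).1 (hr.dualVec i).2
  have hmem : ∀ f : D[X], aeval X f v ∈ E := fun f => (hE _).2 ⟨f, rfl⟩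
  have hort : ∀ x, ∀ u ∈ E, B (h.transfer a c (X, v) (X, v) x) u = B x u := by
    intro x u hu
    have h1 := congrArg Subtype.val (hr.sum_dualVec ⟨u, hu⟩)
    simp only [Submodule.coe_sum, Submodule.coe_smul] at h1
    conv_rhs => rw [← h1]
    simp only [transfer_apply, ha, hc, h.sum_left, h.sum_right, h.smul_left, h.smul_right,
      ← h.conj]
    exact Finset.sum_congr rfl fun i _ => mul_comm _ _
  refine ⟨_, a, c, fun f g => B (aeval X f v) (aeval X g v), hX, fun _ _ => rfl, fun f => ?_,
    fun x f => hort x _ (hmem f), fun x => hμ _ fun u hu => ?_⟩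
  · have h1 := congrArg Subtype.val (hr.sum_vec ⟨_, hmem f⟩)
    simp only [Submodule.coe_sum, Submodule.coe_smul] at h1
    simp only [transfer_apply, ha, hc]
    exact h1
  · rw [h.eq_zero_comm, h.sub_left, hort x u hu, sub_self]

end ExistsModel

section Degeneration

/-- Complementary idempotents `π`, `ρ`, `π'` for which `X` is block upper triangular. -/
structure IsTriangular {A : Type*} [Ring A] (π ρ π' X : A) : Prop where
  sum : π + ρ + π' = 1
  idem : π * π = π
  idem' : π' * π' = π'
  mul_eq : π * π' = 0
  mul_eq' : π' * π = 0
  stable : X * π = π * X * π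
  stable' : π' * X = π' * X * π'

namespace IsTriangular

variable {A : Type*} [Ring A] {π ρ π' X Y : A}

theorem rho_eq (t : IsTriangular π ρ π' X) : ρ = 1 - π - π' := by
  rw [← t.sum]; abel

theorem pi_rho (t : IsTriangular π ρ π' X) : π * ρ = 0 := by
  simp [t.rho_eq, mul_sub, t.idem, t.mul_eq]

theorem rho_pi (t : IsTriangular π ρ π' X) : ρ * π = 0 := by
  simp [t.rho_eq, sub_mul, t.idem, t.mul_eq']

theorem rho_pi' (t : IsTriangular π ρ π' X) : ρ * π' = 0 := by
  simp [t.rho_eq, sub_mul, t.idem', t.mul_eq]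

theorem pi'_rho (t : IsTriangular π ρ π' X) : π' * ρ = 0 := by
  simp [t.rho_eq, mul_sub, t.idem', t.mul_eq']

theorem rho_rho (t : IsTriangular π ρ π' X) : ρ * ρ = ρ := by
  nth_rw 1 [t.rho_eq]
  rw [sub_mul, sub_mul, t.pi_rho, t.pi'_rho, one_mul, sub_zero, sub_zero]

theorem rho_mul_pi (t : IsTriangular π ρ π' X) : ρ * X * π = 0 := by
  rw [mul_assoc, t.stable, ← mul_assoc, ← mul_assoc, t.rho_pi, zero_mul, zero_mul]

theorem pi'_mul_pi (t : IsTriangular π ρ π' X) : π' * X * π = 0 := by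
  rw [mul_assoc, t.stable, ← mul_assoc, ← mul_assoc, t.mul_eq', zero_mul, zero_mul]

theorem pi'_mul_rho (t : IsTriangular π ρ π' X) : π' * X * ρ = 0 := by
  rw [t.stable', mul_assoc, t.pi'_rho, mul_zero]

theorem mul (t : IsTriangular π ρ π' X) (t' : IsTriangular π ρ π' Y) :
    IsTriangular π ρ π' (X * Y) where
  sum := t.sum
  idem := t.idem
  idem' := t.idem'
  mul_eq := t.mul_eq
  mul_eq' := t.mul_eq'
  stable := by
    calc X * Y * π = X * (π * Y * π) := by rw [← t'.stable, mul_assoc]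
      _ = X * π * (Y * π) := by noncomm_ring
      _ = π * X * (π * Y * π) := by rw [t.stable]; noncomm_ring
      _ = _ := by rw [← t'.stable]; noncomm_ring
  stable' := by
    calc π' * (X * Y) = π' * X * π' * Y := by rw [← t.stable', mul_assoc]
      _ = (π' * X) * (π' * Y) := by noncomm_ring
      _ = (π' * X * π') * Y * π' := by rw [t'.stable']; noncomm_ring
      _ = _ := by rw [← t.stable']; noncomm_ring

theorem one (t : IsTriangular π ρ π' X) : IsTriangular π ρ π' 1 :=
  ⟨t.sum, t.idem, t.idem', t.mul_eq, t.mul_eq', by simp [t.idem], by simp [t.idem']⟩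

theorem pow (t : IsTriangular π ρ π' X) (n : ℕ) : IsTriangular π ρ π' (X ^ n) := by
  induction n with
  | zero => simpa using t.one
  | succ n ih => rw [pow_succ]; exact ih.mul t

end IsTriangular

/-- The block diagonal part of `X`. -/
def blockDiag {A : Type*} [Ring A] (π ρ π' X : A) : A := π * X * π + ρ * X * ρ + π' * X * π'

namespace IsTriangular

variable {A : Type*} [Ring A] {π ρ π' X Y : A}

theorem blockDiag_mul (t : IsTriangular π ρ π' X) (t' : IsTriangular π ρ π' Y) :
    blockDiag π ρ π' (X * Y) = blockDiag π ρ π' X * blockDiag π ρ π' Y := by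
  have e1 : π * X * π * (π * Y * π) = π * (X * Y) * π := by
    calc _ = π * X * (π * π) * Y * π := by noncomm_ring
      _ = π * X * (π * Y * π) := by rw [t.idem]; noncomm_ring
      _ = _ := by rw [← t'.stable]; noncomm_ring
  have e2 : ρ * X * ρ * (ρ * Y * ρ) = ρ * (X * Y) * ρ := by
    calc _ = ρ * X * (ρ * ρ) * Y * ρ := by noncomm_ring
      _ = ρ * X * (1 - π - π') * Y * ρ := by rw [t.rho_rho, ← t.rho_eq]
      _ = ρ * (X * Y) * ρ - (ρ * X * π) * Y * ρ - ρ * X * (π' * Y * ρ) := by noncomm_ring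
      _ = _ := by rw [t.rho_mul_pi, t'.pi'_mul_rho]; simp
  have e3 : π' * X * π' * (π' * Y * π') = π' * (X * Y) * π' := by
    calc _ = (π' * X * (π' * π')) * Y * π' := by noncomm_ring
      _ = _ := by rw [t.idem', ← t.stable']; noncomm_ring
  have z : ∀ {a b : A}, a * b = 0 → ∀ {c d e f : A}, c * d * a * (b * e * f) = 0 := by
    intro a b hab c d e f
    calc _ = c * d * (a * b) * e * f := by noncomm_ring
      _ = 0 := by rw [hab]; simp
  simp only [blockDiag, mul_add, add_mul, e1, e2, e3, z t.pi_rho, z t.rho_pi, z t.rho_pi',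
    z t.pi'_rho, z t.mul_eq, z t.mul_eq']
  abel

theorem blockDiag_one (t : IsTriangular π ρ π' X) : blockDiag π ρ π' 1 = 1 := by
  simp [blockDiag, t.idem, t.idem', t.rho_rho, t.sum]

theorem aeval_blockDiag {D : Type*} [Field D] [Algebra D A] (t : IsTriangular π ρ π' X)
    (f : D[X]) : aeval (blockDiag π ρ π' X) f = blockDiag π ρ π' (aeval X f) := by
  induction f using Polynomial.induction_on' with
  | add f g hf hg => rw [map_add, map_add, hf, hg]; simp only [blockDiag]; noncomm_ring
  | monomial n r =>
    have H : ∀ n : ℕ, (blockDiag π ρ π' X) ^ n = blockDiag π ρ π' (X ^ n) := by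
      intro n
      induction n with
      | zero => simp [t.blockDiag_one]
      | succ n ih => rw [pow_succ, pow_succ, (t.pow n).blockDiag_mul t, ih]
    simp only [aeval_monomial, ← Algebra.smul_def, H]
    simp [blockDiag, smul_add]

end IsTriangular

variable {D : Type*} [NontriviallyNormedField D] [CompleteSpace D]
  {V : Type*} [NormedAddCommGroup V] [NormedSpace D V]
  [FiniteDimensional D V] {σ : D ≃+* D} {B : V → V → D}

theorem uConj_blockDiag (h : IsHermForm σ B) (hσ : Continuous σ) {X : V →L[D] V} {v : V}
    (hcl : IsClosed {q | UConj B (X, v) q}) {π ρ : V →L[D] V}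
    (t : IsTriangular π ρ (h.adj π) X) (hv : h.adj π v = 0) :
    UConj B (X, v) (blockDiag π ρ (h.adj π) X, ρ v) := by
  set π' := h.adj π with hπ'
  have hadj' : h.adj π' = π := h.adj_adj π
  have hadjρ : h.adj ρ = ρ := by
    rw [t.rho_eq, h.adj_sub, h.adj_sub, h.adj_one, hadj', ← hπ']; abel
  let L : D → V →L[D] V := fun s => s • π + (σ s)⁻¹ • π' + ρ
  let M : D → V →L[D] V := fun s => s⁻¹ • π + σ s • π' + ρ
  have hLM : ∀ s, h.adj (L s) = M s := fun s => by
    simp only [L, M, h.adj_add, h.adj_smul, hadj', hadjρ, ← hπ', map_inv₀, h.invol]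
    abel
  have hML : ∀ s, s ≠ 0 → M s * L s = 1 := fun s hs => by
    have hs' : σ s ≠ 0 := by simpa using hs
    simp only [L, M, mul_add, add_mul, smul_mul_assoc, mul_smul_comm, smul_smul, t.idem, t.idem',
      t.mul_eq, t.mul_eq', t.pi_rho, t.rho_pi, t.rho_pi', t.pi'_rho, t.rho_rho, smul_zero, add_zero,
      zero_add, mul_inv_cancel₀ hs, inv_mul_cancel₀ hs', one_smul]
    rw [← t.sum]; abel
  have hconj : ∀ s, s ≠ 0 → L s * X * M s = blockDiag π ρ π' X + s • (π * X * ρ) +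
      (s * σ s) • (π * X * π') + σ s • (ρ * X * π') := fun s hs => by
    have hs' : σ s ≠ 0 := by simpa using hs
    simp only [L, M, blockDiag, mul_add, add_mul, smul_add, smul_mul_assoc, mul_smul_comm, smul_smul,
      t.rho_mul_pi, t.pi'_mul_pi, t.pi'_mul_rho, smul_zero, add_zero,
      inv_mul_cancel₀ hs, mul_inv_cancel₀ hs', one_smul]
    rw [mul_comm (σ s) s]
    abel
  have hLv : ∀ s, L s v = s • π v + ρ v := fun s => by
    simp [L, hv]
  have hmem : ∀ s, s ≠ 0 → (blockDiag π ρ π' X + s • (π * X * ρ) +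
      (s * σ s) • (π * X * π') + σ s • (ρ * X * π'), s • π v + ρ v) ∈
      {q | UConj B (X, v) q} := fun s hs => by
    refine h.uConj_of_isometry (L s) (fun a b => ?_) (fun x => ?_) (hLv s).symm
    · rw [← h.adj_right, hLM, ← mul_apply_eq_comp, hML s hs]; rfl
    · change _ = L s (X x)
      rw [← hconj s hs, ← mul_apply_eq_comp, mul_assoc, hML s hs, mul_one]; rfl
  have hc : Continuous fun s : D => (blockDiag π ρ π' X + s • (π * X * ρ) +
      (s * σ s) • (π * X * π') + σ s • (ρ * X * π'), s • π v + ρ v) := by fun_prop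
  have hlim := (hc.tendsto 0).mono_left (nhdsWithin_le_nhds (s := {0}ᶜ))
  simp only [map_zero, zero_smul, mul_zero, add_zero, zero_add] at hlim
  exact hcl.mem_of_tendsto hlim (eventually_mem_nhdsWithin.mono fun s hs => hmem s hs)

theorem exists_isotropic_projection [CharZero D] (h : IsHermForm σ B) {N K : Submodule D V}
    (hN : ∀ x ∈ N, ∀ y ∈ N, B x y = 0) (hK : ∀ x ∈ K, ∀ y ∈ N, B x y = 0) (hd : Disjoint K N) :
    ∃ π : V →L[D] V, π * π = π ∧ h.adj π * π = 0 ∧ π * h.adj π = 0 ∧ (∀ x, π x ∈ N) ∧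
      (∀ x ∈ N, π x = x) ∧ ∀ x ∈ K, π x = 0 := by
  obtain ⟨K', hKK', hc⟩ := hd.exists_isCompl
  let P : V →L[D] V := LinearMap.toContinuousLinearMap (N.projection K' hc.symm)
  have hPN : ∀ x, P x ∈ N := fun x => Submodule.projection_apply_mem _ x
  have hPf : ∀ x ∈ N, P x = x := fun x hx => Submodule.projection_apply_left hc.symm ⟨x, hx⟩
  have hPK : ∀ x ∈ K, P x = 0 := fun x hx =>
    (Submodule.projection_apply_eq_zero_iff hc.symm).2 (hKK' hx)
  have hPadj : ∀ x, (∀ y ∈ N, B x y = 0) → h.adj P x = 0 := fun x hx =>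
    h.nondeg _ fun w => by rw [h.adj_left, hx _ (hPN w)]
  have i1 : P * P = P := by ext x; exact hPf _ (hPN x)
  have i2 : h.adj P * P = 0 := by ext x; exact hPadj _ (hN _ (hPN x))
  have i3 : h.adj P * h.adj P = h.adj P := by rw [← h.adj_mul, i1]
  set k := P * h.adj P with hk
  have hka : h.adj k = k := by rw [hk, h.adj_mul, h.adj_adj]
  have k1 : P * k = k := by rw [hk, ← mul_assoc, i1]
  have k2 : k * P = 0 := by rw [hk, mul_assoc, i2, mul_zero]
  have k3 : k * h.adj P = k := by rw [hk, mul_assoc, i3]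
  have k4 : h.adj P * k = 0 := by rw [hk, ← mul_assoc, i2, zero_mul]
  have k5 : k * k = 0 := by
    nth_rw 2 [hk]
    rw [← mul_assoc, k2, zero_mul]
  have hadj : h.adj (P - (2⁻¹ : D) • k) = h.adj P - (2⁻¹ : D) • k := by
    rw [h.adj_sub, h.adj_smul, hka, map_inv₀, map_ofNat]
  have hhalf : (2⁻¹ : D) • k + (2⁻¹ : D) • k = k := by
    rw [← add_smul, ← two_mul, mul_inv_cancel₀ two_ne_zero, one_smul]
  refine ⟨P - (2⁻¹ : D) • k, ?_, ?_, ?_, fun x => ?_, fun x hx => ?_, fun x hx => ?_⟩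
  · simp [mul_sub, sub_mul, i1, k1, k2, k5]
  · rw [hadj]
    simp [mul_sub, sub_mul, i2, k2, k4, k5]
  · rw [hadj]
    simp only [mul_sub, sub_mul, smul_mul_assoc, mul_smul_comm, k1, k3, k5, smul_zero, sub_zero,
      ← hk]
    rw [sub_sub, hhalf, sub_self]
  · exact N.sub_mem (hPN x) (N.smul_mem _ (hPN _))
  · simp [hk, hPadj x (hN x hx), hPf x hx]
  · simp [hk, hPadj x (hK x hx), hPK x hx]

end Degeneration

section ClosedOrbit

variable {D : Type*} [NontriviallyNormedField D] [CompleteSpace D]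
  {V : Type*} [NormedAddCommGroup V] [NormedSpace D V]
  [FiniteDimensional D V] {σ : D ≃+* D} {B : V → V → D}

/-- A closed orbit contains its degeneration along a stable isotropic subspace `N`. -/
theorem exists_uConj_blockDiag [CharZero D] (h : IsHermForm σ B) (hσ : Continuous σ)
    {X : V →L[D] V} (hX : ∀ a b, B (X a) b = -B a (X b)) {v : V}
    (hcl : IsClosed {q | UConj B (X, v) q}) {N K : Submodule D V}
    (hN : ∀ x ∈ N, ∀ y ∈ N, B x y = 0) (hNX : ∀ x ∈ N, X x ∈ N)
    (hv : ∀ y ∈ N, B v y = 0)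
    (hK : ∀ x ∈ K, ∀ y ∈ N, B x y = 0) (hd : Disjoint K N) :
    ∃ π ρ : V →L[D] V, IsTriangular π ρ (h.adj π) X ∧ (∀ x, π x ∈ N) ∧ (∀ x ∈ N, π x = x) ∧
      (∀ x ∈ K, π x = 0) ∧ (∀ x, (∀ y ∈ N, B x y = 0) → h.adj π x = 0) ∧
      UConj B (X, v) (blockDiag π ρ (h.adj π) X, ρ v) := by
  obtain ⟨π, h1, h2, h3, hπN, hπf, hπK⟩ := h.exists_isotropic_projection hN hK hd
  have hst : X * π = π * X * π := by
    ext x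
    exact (hπf _ (hNX _ (hπN x))).symm
  have t : IsTriangular π (1 - π - h.adj π) (h.adj π) X :=
    { sum := by abel
      idem := h1
      idem' := by rw [← h.adj_mul, h1]
      mul_eq := h3
      mul_eq' := h2
      stable := hst
      stable' := by
        have := congrArg h.adj hst
        simpa [h.adj_mul, h.adj_eq_neg hX, mul_assoc] using this }
  have hadj : ∀ x, (∀ y ∈ N, B x y = 0) → h.adj π x = 0 := fun x hx =>
    h.nondeg _ fun w => by rw [h.adj_left, hx _ (hπN w)]
  exact ⟨π, _, t, hπN, hπf, hπK, hadj, h.uConj_blockDiag hσ hcl t (hadj v hv)⟩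

theorem nondegenerate_of_isClosed [CharZero D] (h : IsHermForm σ B) (hσ : Continuous σ)
    {X : V →L[D] V} (hX : ∀ a b, B (X a) b = -B a (X b)) {v : V}
    (hcl : IsClosed {q | UConj B (X, v) q}) {E : Submodule D V}
    (hE : ∀ x, x ∈ E ↔ ∃ f : D[X], aeval X f v = x) (hEX : ∀ x ∈ E, X x ∈ E) (hvE : v ∈ E) :
    ∀ u ∈ E, (∀ u' ∈ E, B u u' = 0) → u = 0 := by
  intro u hu hu'
  let N : Submodule D V :=
    { carrier := {x | x ∈ E ∧ ∀ u ∈ E, B x u = 0}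
      add_mem' := fun {a b} ha hb =>
        ⟨E.add_mem ha.1 hb.1, fun u hu => by rw [h.add_left, ha.2 u hu, hb.2 u hu, add_zero]⟩
      zero_mem' := ⟨E.zero_mem, fun u _ => h.zero_left u⟩
      smul_mem' := fun c {a} ha =>
        ⟨E.smul_mem c ha.1, fun u hu => by rw [h.smul_left, ha.2 u hu, mul_zero]⟩ }
  have hEN : ∀ x ∈ E, ∀ y ∈ N, B x y = 0 := fun x hx y hy => h.eq_zero_comm.1 (hy.2 x hx)
  obtain ⟨π, ρ, t, hπN, hπf, -, hadj, g, -, hg1, hg2⟩ :=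
    h.exists_uConj_blockDiag hσ hX hcl (N := N) (K := ⊥) (fun x hx => hEN x hx.1)
      (fun x hx => ⟨hEX x hx.1, fun w hw => by rw [hX, hx.2 _ (hEX w hw), neg_zero]⟩)
      (hEN v hvE) (by simp [h.zero_left]) disjoint_bot_left
  simp only at hg1 hg2
  obtain ⟨f, rfl⟩ := (hE u).1 hu
  have e1 : aeval (blockDiag π ρ (h.adj π) X) f (ρ v) = ρ (aeval X f v) := by
    refine aeval_apply_of_semiconj (s := (E : Set V)) hEX (map_add ρ) (map_smul ρ)
      (fun x hx => ?_) f hvE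
    have h1 : ∀ y, π (ρ y) = 0 := fun y => DFunLike.congr_fun t.pi_rho y
    have h2 : ∀ y, h.adj π (ρ y) = 0 := fun y => DFunLike.congr_fun t.pi'_rho y
    have h3 : ∀ y, ρ (ρ y) = ρ y := fun y => DFunLike.congr_fun t.rho_rho y
    have h4 : ∀ y, ρ (X (π y)) = 0 := fun y => DFunLike.congr_fun t.rho_mul_pi y
    have h5 : π x + ρ x + h.adj π x = x := DFunLike.congr_fun t.sum x
    rw [hadj x (hEN x hx), add_zero] at h5
    conv_rhs => rw [← h5, map_add, map_add, h4, zero_add]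
    simp [blockDiag, h1, h2, h3]
  have e2 : aeval (blockDiag π ρ (h.adj π) X) f (g v) = g (aeval X f v) :=
    aeval_apply_of_semiconj (s := Set.univ) (by simp) (map_add g) (map_smul g)
      (fun x _ => hg1 x) f (Set.mem_univ _)
  have e3 : ρ (aeval X f v) = 0 := by
    rw [← hπf _ (show aeval X f v ∈ N from ⟨hu, hu'⟩)]
    exact DFunLike.congr_fun t.rho_pi _
  rw [← hg2, e1, e3] at e2
  simpa using e2.symm

theorem exists_isotropic_nilpotent (h : IsHermForm σ B) {X : V →L[D] V}
    (hX : ∀ a b, B (X a) b = -B a (X b)) {F : Submodule D V}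
    {f : D[X]} (hf : ∃ x ∈ F, aeval X f x ≠ 0)
    (hff : ∀ x ∈ F, aeval X (f * f) x = 0) :
    ∃ f : D[X], (∃ x ∈ F, aeval X f x ≠ 0) ∧ (∀ x ∈ F, aeval X f (aeval X f x) = 0) ∧
      ∀ x ∈ F, ∀ y ∈ F, B (aeval X f x) (aeval X f y) = 0 := by
  obtain ⟨f', hf'⟩ := h.exists_adj_aeval (h.adj_eq_neg hX) f
  have hmul : ∀ (p q : D[X]) x, aeval X (p * q) x = aeval X p (aeval X q x) := by simp
  have hcomm : ∀ (p q : D[X]) x, aeval X p (aeval X q x) = aeval X q (aeval X p x) := by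
    intro p q x
    rw [← hmul, mul_comm, hmul]
  simp only [hmul] at hff
  by_cases H : ∀ x ∈ F, aeval X f' (aeval X f x) = 0
  · exact ⟨f, hf, hff, fun x _ y hy => by rw [← h.adj_right, hf', H y hy, h.zero_right]⟩
  · push Not at H
    obtain ⟨x₀, hx₀, h0⟩ := H
    have hsq : ∀ x ∈ F, aeval X (f' * f) (aeval X (f' * f) x) = 0 := fun x hx => by
      rw [hmul, hmul, hcomm f f', hff x hx, map_zero, map_zero]
    have hself : h.adj (aeval X (f' * f)) = aeval X (f' * f) := by
      rw [map_mul, h.adj_mul, ← hf', h.adj_adj]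
    refine ⟨f' * f, ⟨x₀, hx₀, by rwa [hmul]⟩, hsq, fun x _ y hy => ?_⟩
    rw [← h.adj_right, hself, hsq y hy, h.zero_right]

theorem isSemisimple_of_isClosed [CharZero D] (h : IsHermForm σ B) (hσ : Continuous σ)
    {X : V →L[D] V} (hX : ∀ a b, B (X a) b = -B a (X b)) {v : V}
    (hcl : IsClosed {q | UConj B (X, v) q}) {E F : Submodule D V}
    (hE : ∀ x, x ∈ E ↔ ∃ f : D[X], aeval X f v = x) (hvE : v ∈ E)
    (hnd : ∀ u ∈ E, (∀ u' ∈ E, B u u' = 0) → u = 0)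
    (hEF : ∀ x, x ∈ F ↔ ∀ u ∈ E, B u x = 0)
    (hF : F ∈ Module.End.invtSubmodule (X : V →ₗ[D] V)) :
    Module.End.IsSemisimple (LinearMap.restrict (X : V →ₗ[D] V) hF) := by
  by_contra hs
  obtain ⟨b, hb, hbb⟩ := exists_nilpotent_of_not_isSemisimple hs
  have hFs : ∀ (f : D[X]), ∀ x ∈ F, aeval X f x ∈ F := fun f x hx => by
    rw [← coe_aeval_restrict X hF f ⟨x, hx⟩]
    exact Subtype.prop _
  obtain ⟨f, ⟨x₀, hx₀, hne⟩, hff, hiso⟩ := h.exists_isotropic_nilpotent hX hb hbb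
  let N : Submodule D V := F.map ((aeval X f : V →L[D] V) : V →ₗ[D] V)
  have hmemN : ∀ x, x ∈ N ↔ ∃ y ∈ F, aeval X f y = x := fun x => Iff.rfl
  have hNF : N ≤ F := by
    rintro _ ⟨y, hy, rfl⟩
    exact hFs f y hy
  have hXf : ∀ x, X (aeval X f x) = aeval X f (X x) := fun x => by
    have : aeval X (Polynomial.X * f) x = aeval X (f * Polynomial.X) x := by rw [mul_comm]
    simpa using this
  have hEN : ∀ x ∈ E, ∀ y ∈ N, B x y = 0 := fun x hx y hy => (hEF y).1 (hNF hy) x hx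
  have hNN : ∀ x ∈ N, ∀ y ∈ N, B x y = 0 := by
    rintro _ ⟨x, hx, rfl⟩ _ ⟨y, hy, rfl⟩
    exact hiso x hx y hy
  obtain ⟨π, ρ, t, hπN, hπf, hπK, hadj, g, hg, hg1, hg2⟩ :=
    h.exists_uConj_blockDiag hσ hX hcl (N := N) (K := E) hNN
      (by rintro _ ⟨x, hx, rfl⟩; exact ⟨X x, hF hx, (hXf x).symm⟩)
      (hEN v hvE) hEN
      (Submodule.disjoint_def.2 fun x hx hx' => hnd x hx fun u hu =>
        h.eq_zero_comm.1 ((hEF x).1 (hNF hx') u hu))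
  simp only at hg1 hg2
  have hsum : ∀ x, π x + ρ x + h.adj π x = x := fun x => DFunLike.congr_fun t.sum x
  have hadjE : ∀ x ∈ E, h.adj π x = 0 := fun x hx => hadj x (hEN x hx)
  have hρE : ∀ x ∈ E, ρ x = x := fun x hx => by
    have := hsum x
    rwa [hπK x hx, hadjE x hx, zero_add, add_zero] at this
  have hgE : ∀ x ∈ E, g x = x := fun x hx => by
    obtain ⟨p, rfl⟩ := (hE x).1 hx
    have e : aeval (blockDiag π ρ (h.adj π) X) p (g v) = g (aeval X p v) :=
      aeval_apply_of_semiconj (s := Set.univ) (by simp) (map_add g) (map_smul g)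
        (fun x _ => hg1 x) p (Set.mem_univ _)
    rw [← e, ← hg2, hρE v hvE, t.aeval_blockDiag]
    simp [blockDiag, hπK v hvE, hadjE v hvE, hρE v hvE, hρE _ hx]
  have hgF : ∀ x ∈ F, g x ∈ F := fun x hx => (hEF _).2 fun u hu => by
    rw [← hgE u hu, hg]
    exact (hEF x).1 hx u hu
  have hadjF : ∀ x ∈ F, h.adj π x ∈ F := fun x hx => (hEF _).2 fun u hu => by
    rw [h.adj_right, hπK u hu, h.zero_left]
  have hρF : ∀ x ∈ F, ρ x ∈ F := fun x hx => by
    have : ρ x = x - π x - h.adj π x := by rw [← sub_eq_zero]; nth_rw 2 [← hsum x]; abel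
    rw [this]
    exact F.sub_mem (F.sub_mem hx (hNF (hπN x))) (hadjF x hx)
  have hfN : ∀ x ∈ N, aeval X f x = 0 := by
    rintro _ ⟨y, hy, rfl⟩
    exact hff y hy
  have hρN : ∀ x ∈ N, ρ x = 0 := fun x hx => by
    rw [← hπf x hx]
    exact DFunLike.congr_fun t.rho_pi x
  have hadjN : ∀ x ∈ N, h.adj π x = 0 := fun x hx => hadj x (hNN x hx)
  have hzero : ∀ u ∈ F, aeval (blockDiag π ρ (h.adj π) X) f u = 0 := fun u hu => by
    rw [t.aeval_blockDiag]
    simp [blockDiag, hfN _ (hπN u), hρN _ ((hmemN _).2 ⟨_, hρF u hu, rfl⟩),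
      hadjN _ ((hmemN _).2 ⟨_, hadjF u hu, rfl⟩)]
  have e : aeval (blockDiag π ρ (h.adj π) X) f (g x₀) = g (aeval X f x₀) :=
    aeval_apply_of_semiconj (s := Set.univ) (by simp) (map_add g) (map_smul g)
      (fun x _ => hg1 x) f (Set.mem_univ _)
  rw [hzero _ (hgF x₀ hx₀)] at e
  exact hne (by simpa using e.symm)

theorem isClosed_iff [CharZero D] (h : IsHermForm σ B) (hσ : Continuous σ)
    {X : V →L[D] V} (hX : ∀ a b, B (X a) b = -B a (X b)) {v : V} {E F : Submodule D V}
    (hE : ∀ x, x ∈ E ↔ ∃ f : D[X], aeval X f v = x)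
    (hEF : ∀ x, x ∈ F ↔ ∀ u ∈ E, B u x = 0)
    (hF : F ∈ Module.End.invtSubmodule (X : V →ₗ[D] V)) :
    IsClosed {q | UConj B (X, v) q} ↔ (∀ u ∈ E, (∀ u' ∈ E, B u u' = 0) → u = 0) ∧
      Module.End.IsSemisimple (LinearMap.restrict (X : V →ₗ[D] V) hF) := by
  have hvE : v ∈ E := (hE v).2 ⟨1, by simp⟩
  have hEX : ∀ x ∈ E, X x ∈ E := fun x hx => by
    obtain ⟨f, rfl⟩ := (hE x).1 hx
    exact (hE _).2 ⟨Polynomial.X * f, by simp⟩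
  refine ⟨fun hcl => ?_, fun ⟨hnd, hs⟩ => ?_⟩
  · have hnd := h.nondegenerate_of_isClosed hσ hX hcl hE hEX hvE
    exact ⟨hnd, h.isSemisimple_of_isClosed hσ hX hcl hE hvE hnd hEF hF⟩
  · obtain ⟨μ, hμ, hμF⟩ := exists_separable_of_isSemisimple hs
    obtain ⟨m, a, c, γ, hp⟩ := h.exists_isModel hX hE hnd fun x hx => hμF x ((hEF x).2 hx)
    exact hp.isClosed_orbit hσ hμ

end ClosedOrbit

end IsHermForm

theorem mem_span_pow_iff {D V : Type*} [NontriviallyNormedField D] [NormedAddCommGroup V]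
    [NormedSpace D V] (X : V →L[D] V) (v x : V) :
    x ∈ Submodule.span D (Set.range fun j : ℕ => (X ^ j) v) ↔ ∃ f : D[X], aeval X f v = x := by
  constructor
  · intro hx
    induction hx using Submodule.span_induction with
    | mem x hx =>
      obtain ⟨j, rfl⟩ := hx
      exact ⟨Polynomial.X ^ j, by simp⟩
    | zero => exact ⟨0, by simp⟩
    | add x y _ _ hx hy =>
      obtain ⟨f, rfl⟩ := hx
      obtain ⟨f', rfl⟩ := hy
      exact ⟨f + f', by simp⟩
    | smul c x _ hx =>
      obtain ⟨f, rfl⟩ := hx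
      exact ⟨C c * f, by simp [← Algebra.smul_def]⟩
  · rintro ⟨f, rfl⟩
    induction f using Polynomial.induction_on' with
    | add f f' hf hf' =>
      rw [map_add]
      exact Submodule.add_mem _ hf hf'
    | monomial n r =>
      rw [aeval_monomial, ← Algebra.smul_def]
      exact Submodule.smul_mem _ _ (Submodule.subset_span ⟨n, rfl⟩)

end HelperLemmas

/-- Over a non-archimedean local field `D` of characteristic `0` with continuous
involution, let `⟨·,·⟩` be a nondegenerate hermitian form on `V`, `G` its unitary group,
`X` skew-adjoint, `v ∈ V`, and `E` the span of `{X^j v}`.  The `G`-orbit of `(X, v)` is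
closed in `End(V) × V` iff the restriction of `⟨·,·⟩` to `E` is nondegenerate and the
restriction of `X` to `E^⊥` is semisimple (every `X`-invariant subspace of `E^⊥` has an
`X`-invariant complement in `E^⊥`). -/
theorem statement16 {D : Type*} [NontriviallyNormedField D] [CompleteSpace D]
    [LocallyCompactSpace D] [TotallyDisconnectedSpace D] [CharZero D]
    {V : Type*} [NormedAddCommGroup V] [NormedSpace D V] [FiniteDimensional D V]
    {n : ℕ} (hn : 1 ≤ n) (hdim : Module.finrank D V = n)
    (σ : D ≃+* D) (hσ : ∀ d : D, σ (σ d) = d) (hσc : Continuous σ)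
    (B : V → V → D)
    (hB1 : ∀ v v' w : V, B (v + v') w = B v w + B v' w)
    (hB2 : ∀ v w w' : V, B v (w + w') = B v w + B v w')
    (hB3 : ∀ (d d' : D) (v w : V), B (d • v) (d' • w) = d * σ d' * B v w)
    (hB4 : ∀ v w : V, B w v = σ (B v w))
    (hBnd : ∀ v : V, (∀ w : V, B v w = 0) → v = 0)
    (X : V →L[D] V) (hX : ∀ a b : V, B (X a) b = - B a (X b)) (v : V)
    (E : Submodule D V) (hE : E = Submodule.span D (Set.range fun j : ℕ => (X ^ j) v))
    (Eperp : Set V) (hEperp : Eperp = {w : V | ∀ u ∈ E, B u w = 0}) :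
    IsClosed {p : (V →L[D] V) × V |
        ∃ g : V ≃L[D] V, (∀ a b : V, B (g a) (g b) = B a b) ∧
          p = ((g : V →L[D] V).comp (X.comp (g.symm : V →L[D] V)), g v)} ↔
      ((∀ u ∈ E, (∀ u' ∈ E, B u u' = 0) → u = 0) ∧
        ∀ p : Submodule D V, (p : Set V) ⊆ Eperp → (∀ x ∈ p, X x ∈ p) →
          ∃ q : Submodule D V, (q : Set V) ⊆ Eperp ∧ (∀ x ∈ q, X x ∈ q) ∧
            p ⊓ q = ⊥ ∧ ∀ z ∈ Eperp, ∃ a ∈ p, ∃ b ∈ q, z = a + b) := by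
  have h : IsHermForm σ B := ⟨hσ, hB1, hB2, hB3, hB4, hBnd⟩
  have hmem : ∀ x, x ∈ E ↔ ∃ f : Polynomial D, Polynomial.aeval X f v = x := fun x => by
    rw [hE, mem_span_pow_iff]
  have hEX : ∀ x ∈ E, X x ∈ E := fun x hx => by
    obtain ⟨f, rfl⟩ := (hmem x).1 hx
    exact (hmem _).2 ⟨Polynomial.X * f, by simp⟩
  let F : Submodule D V :=
    { carrier := Eperp
      add_mem' := fun {a b} ha hb => by
        rw [hEperp] at *
        exact fun u hu => by rw [hB2, ha u hu, hb u hu, add_zero]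
      zero_mem' := by
        rw [hEperp]
        exact fun u _ => h.zero_right u
      smul_mem' := fun c {a} ha => by
        rw [hEperp] at *
        exact fun u hu => by rw [h.smul_right, ha u hu, mul_zero] }
  have hFE : (F : Set V) = Eperp := rfl
  have hEF : ∀ x, x ∈ F ↔ ∀ u ∈ E, B u x = 0 := fun x => by
    rw [← SetLike.mem_coe, hFE, hEperp]
    rfl
  have hF : F ∈ Module.End.invtSubmodule (X : V →ₗ[D] V) := fun x hx =>
    (hEF _).2 fun u hu => by
      have := hX u x
      rw [(hEF x).1 hx _ (hEX u hu)] at this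
      exact neg_eq_zero.1 this.symm
  have hset : {p : (V →L[D] V) × V | ∃ g : V ≃L[D] V, (∀ a b : V, B (g a) (g b) = B a b) ∧
      p = ((g : V →L[D] V).comp (X.comp (g.symm : V →L[D] V)), g v)} =
      {q | UConj B (X, v) q} := by
    ext q
    exact (uConj_iff (X, v) q).symm
  rw [hset, h.isClosed_iff hσc hX hmem hEF hF, Module.End.isSemisimple_restrict_iff]
  refine and_congr_right fun _ => ⟨fun H p hp hpX => ?_, fun H p hpX hp => ?_⟩
  · obtain ⟨q, hq, hqX, hd, hs⟩ := H p hpX hp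
    refine ⟨q, hq, hqX, hd.eq_bot, fun z hz => ?_⟩
    have hz' : z ∈ p ⊔ q := hs ▸ (hz : z ∈ F)
    obtain ⟨a, ha, b, hb, hab⟩ := Submodule.mem_sup.1 hz'
    exact ⟨a, ha, b, hb, hab.symm⟩
  · obtain ⟨q, hq, hqX, hd, hs⟩ := H p hp hpX
    refine ⟨q, hq, hqX, disjoint_iff.2 hd, le_antisymm (sup_le hp hq) fun z hz => ?_⟩
    obtain ⟨a, ha, b, hb, rfl⟩ := hs z hz
    exact Submodule.add_mem_sup ha hb
end

section
/- Let X be a skew-adjoint endomorphism of V and v ∈ V, and set q_j = ⟨X^j v, v⟩. Then ⟨X^i v, X^j v⟩ = (−1)^j q_{i+j} for all i, j, and the following are equivalent: (i) for every r ∈ {1, …, n} the r×r matrix with (i,j) entry ⟨X^{i−1}v, X^{j−1}v⟩ (1 ≤ i, j ≤ r) is singular; (ii) q_j = 0 for j = 0, …, n−1; (iii) q_j = 0 for all j ∈ ℕ; (iv) the subspace of V spanned by {X^j v : j ∈ ℕ} is totally isotropic for ⟨·,·⟩. -/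
/-- A square matrix that vanishes strictly above its anti-diagonal and is singular has a zero
entry on the anti-diagonal. -/
theorem Matrix.exists_antidiag_eq_zero_of_det_eq_zero {R : Type*} [CommRing R] [IsDomain R]
    {r : ℕ} (M : Matrix (Fin r) (Fin r) R)
    (hM : ∀ i j : Fin r, (i : ℕ) + j + 1 < r → M i j = 0) (hdet : M.det = 0) :
    ∃ i : Fin r, M i.rev i = 0 := by
  have htri : (M.submatrix Fin.revPerm id).IsUpperTriangular := by
    intro i j hij
    have hij : (j : ℕ) < i := hij
    apply hM
    rw [Fin.revPerm_apply, Fin.val_rev, id_eq]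
    omega
  have h := Matrix.det_of_isUpperTriangular htri
  rw [Matrix.det_permute, hdet, mul_zero] at h
  obtain ⟨i, -, hi⟩ := Finset.prod_eq_zero_iff.mp h.symm
  exact ⟨i, hi⟩

/-- A linear map vanishing on `X ^ j v` for all `j` below the dimension vanishes on `X ^ j v`
for all `j`. -/
theorem LinearMap.apply_pow_apply_eq_zero_of_lt_finrank {K V W : Type*} [Field K]
    [AddCommGroup V] [Module K V] [FiniteDimensional K V] [AddCommGroup W] [Module K W]
    (f : V →ₗ[K] W) (X : V →ₗ[K] V) (v : V)
    (h : ∀ j < Module.finrank K V, f ((X ^ j) v) = 0) (j : ℕ) : f ((X ^ j) v) = 0 := by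
  by_cases hj : j < Module.finrank K V
  · exact h j hj
  rcases (Module.finrank K V).eq_zero_or_pos with hzero | hpos
  · have := Module.finrank_zero_iff.mp hzero
    rw [Subsingleton.elim ((X ^ j) v) 0, map_zero]
  · rw [LinearMap.pow_eq_aeval_mod_charpoly, Polynomial.aeval_eq_sum_range,
      LinearMap.sum_apply, map_sum]
    refine Finset.sum_eq_zero fun k hk => ?_
    rw [LinearMap.smul_apply, map_smul, h k, smul_zero]
    have hlt := Polynomial.natDegree_modByMonic_lt (Polynomial.X ^ j) X.charpoly_monic
      (fun hone => by
        have := X.charpoly_natDegree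
        rw [hone, Polynomial.natDegree_one] at this
        omega)
    rw [X.charpoly_natDegree] at hlt
    have := Finset.mem_range.mp hk
    omega

/-- Let `⟨·,·⟩` be a nondegenerate hermitian form on an `n`-dimensional space `V` over a
field `D` with involution, `X` skew-adjoint and `v ∈ V`; set `q_j = ⟨X^j v, v⟩`.  Then
`⟨X^i v, X^j v⟩ = (−1)^j q_{i+j}` for all `i, j`, and the following are equivalent:
(i) for every `1 ≤ r ≤ n` the `r×r` matrix with entries `⟨X^{i−1}v, X^{j−1}v⟩` is
singular; (ii) `q_j = 0` for `j = 0, …, n−1`; (iii) `q_j = 0` for all `j ∈ ℕ`;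
(iv) the span of `{X^j v : j ∈ ℕ}` is totally isotropic. -/
theorem statement17 {D V : Type*} [Field D] [AddCommGroup V] [Module D V]
    [FiniteDimensional D V] {n : ℕ} (hn : 1 ≤ n) (hdim : Module.finrank D V = n)
    (σ : D ≃+* D) (hσ : ∀ d : D, σ (σ d) = d)
    (B : V → V → D)
    (hB1 : ∀ v v' w : V, B (v + v') w = B v w + B v' w)
    (hB2 : ∀ v w w' : V, B v (w + w') = B v w + B v w')
    (hB3 : ∀ (d d' : D) (v w : V), B (d • v) (d' • w) = d * σ d' * B v w)
    (hB4 : ∀ v w : V, B w v = σ (B v w))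
    (hBnd : ∀ v : V, (∀ w : V, B v w = 0) → v = 0)
    (X : V →ₗ[D] V) (hX : ∀ a b : V, B (X a) b = - B a (X b)) (v : V) :
    (∀ i j : ℕ, B ((X ^ i) v) ((X ^ j) v) = (-1 : D) ^ j * B ((X ^ (i + j)) v) v) ∧
    [∀ r : ℕ, 1 ≤ r → r ≤ n →
        (Matrix.of fun i j : Fin r => B ((X ^ (i : ℕ)) v) ((X ^ (j : ℕ)) v)).det = 0,
      ∀ j < n, B ((X ^ j) v) v = 0,
      ∀ j : ℕ, B ((X ^ j) v) v = 0,
      ∀ u ∈ Submodule.span D (Set.range fun j : ℕ => (X ^ j) v),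
        ∀ u' ∈ Submodule.span D (Set.range fun j : ℕ => (X ^ j) v),
          B u u' = 0].TFAE := by
  have hB_zero_left : ∀ w : V, B 0 w = 0 := fun w => by simpa using hB1 0 0 w
  have hB_zero_right : ∀ w : V, B w 0 = 0 := fun w => by simpa using hB2 w 0 0
  have hsmul_left : ∀ (d : D) (a b : V), B (d • a) b = d * B a b := fun d a b => by
    simpa using hB3 d 1 a b
  have hsmul_right : ∀ (d : D) (a b : V), B a (d • b) = σ d * B a b := fun d a b => by
    simpa using hB3 1 d a b
  have hgram : ∀ i j : ℕ,
      B ((X ^ i) v) ((X ^ j) v) = (-1 : D) ^ j * B ((X ^ (i + j)) v) v := by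
    intro i j
    induction j generalizing i with
    | zero => simp
    | succ j ih =>
      have hskew := hX ((X ^ i) v) ((X ^ j) v)
      rw [← Module.End.mul_apply, ← Module.End.mul_apply, ← pow_succ', ← pow_succ', ih] at hskew
      rw [← neg_eq_iff_eq_neg.mpr hskew, add_right_comm i 1 j, ← add_assoc, pow_succ]
      ring
  refine ⟨hgram, ?_⟩
  tfae_have 1 → 2 := by
    intro h j
    induction j using Nat.strong_induction_on with
    | _ j ih =>
      intro hj
      obtain ⟨i, hi⟩ := Matrix.exists_antidiag_eq_zero_of_det_eq_zero _ (fun i k hik => by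
        rw [Matrix.of_apply, hgram, ih _ (by omega) (by omega), mul_zero])
        (h (j + 1) (by omega) (by omega))
      rw [Matrix.of_apply, hgram, Fin.val_rev,
        show j + 1 - ((i : ℕ) + 1) + i = j by omega] at hi
      exact (mul_eq_zero.mp hi).resolve_left (pow_ne_zero _ (neg_ne_zero.mpr one_ne_zero))
  tfae_have 2 → 3 := fun h =>
    LinearMap.apply_pow_apply_eq_zero_of_lt_finrank
      { toFun := fun u => B u v
        map_add' := fun a b => hB1 a b v
        map_smul' := fun d a => hsmul_left d a v } X v (hdim ▸ h)
  tfae_have 3 → 4 := by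
    intro h u hu u' hu'
    induction hu, hu' using Submodule.span_induction₂ with
    | mem_mem a b ha hb =>
      obtain ⟨i, rfl⟩ := ha
      obtain ⟨j, rfl⟩ := hb
      simp only [hgram, h, mul_zero]
    | zero_left b hb => exact hB_zero_left b
    | zero_right a ha => exact hB_zero_right a
    | add_left a b c ha hb hc hac hbc => rw [hB1, hac, hbc, add_zero]
    | add_right a b c ha hb hc hab hac => rw [hB2, hab, hac, add_zero]
    | smul_left d a b ha hb hab => rw [hsmul_left, hab, mul_zero]
    | smul_right d a b ha hb hab => rw [hsmul_right, hab, mul_zero]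
  tfae_have 4 → 1 := by
    intro h r hr _
    refine Matrix.det_eq_zero_of_row_eq_zero ⟨0, hr⟩ fun j => ?_
    exact h _ (Submodule.subset_span ⟨_, rfl⟩) _ (Submodule.subset_span ⟨_, rfl⟩)
  tfae_finish
end
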